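/- arXiv:1812.11329 — 5 statements merged into one kernel-verified Lean document; each statement's English description precedes it below -/
import Mathlib

section
/- Let f : ℝ^d → ℝ be lower semicontinuous, sign-invariant, with f(0) = 0 and f(x + y) ≥ f(x) for all x, y ∈ ℝ^d with nonnegative entries, and let λ ≥ 0. Then for every x ∈ ℝ^d, Q_2(f + λ‖·‖₁)(x) = Q_2(f)(x) + λ‖x‖₁. -/
noncomputable section

open scoped BigOperators

/-- ℓ¹ norm on ℝ^d -/
def l1 {d : ℕ} (x : Fin d → ℝ) : ℝ := ∑ i, |x i|

/-- squared Euclidean norm on ℝ^d -/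
def sqnorm {d : ℕ} (x : Fin d → ℝ) : ℝ := ∑ i, (x i) ^ 2

/-- Euclidean inner product on ℝ^d -/
def ip {d : ℕ} (x y : Fin d → ℝ) : ℝ := ∑ i, x i * y i

/-- Fenchel conjugate `g*(y) = sup_x ⟨x,y⟩ − g(x)` -/
def fconj {d : ℕ} (g : (Fin d → ℝ) → ℝ) (y : Fin d → ℝ) : ℝ := ⨆ x, ip x y - g x

/-- quadratic envelope `Q₂(f)(x) = (f + ‖·‖²)**(x) − ‖x‖²` -/
def Q2 {d : ℕ} (f : (Fin d → ℝ) → ℝ) (x : Fin d → ℝ) : ℝ :=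
  fconj (fconj fun v => f v + sqnorm v) x - sqnorm x

/-- The sign of a real number, with the convention that the sign of `0` is `1`. -/
def sgnOne (t : ℝ) : ℝ := if 0 ≤ t then 1 else -1

lemma sgnOne_eq_or (t : ℝ) : sgnOne t = 1 ∨ sgnOne t = -1 := by
  unfold sgnOne
  split_ifs <;> simp

lemma sgnOne_mul_self (t : ℝ) : sgnOne t * t = |t| := by
  unfold sgnOne
  split_ifs with h
  · rw [abs_of_nonneg h, one_mul]
  · rw [abs_of_neg (not_le.mp h)]
    ring

lemma abs_sgnOne (t : ℝ) : |sgnOne t| = 1 := by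
  rcases sgnOne_eq_or t with h | h <;> simp [h]

lemma ip_comm {d : ℕ} (x y : Fin d → ℝ) : ip x y = ip y x :=
  Finset.sum_congr rfl fun _ _ => mul_comm _ _

lemma l1_nonneg {d : ℕ} (x : Fin d → ℝ) : 0 ≤ l1 x :=
  Finset.sum_nonneg fun _ _ => abs_nonneg _

lemma bddAbove_fconj {d : ℕ} {g : (Fin d → ℝ) → ℝ} (hg : ∀ v, sqnorm v ≤ g v)
    (y : Fin d → ℝ) : BddAbove (Set.range fun x => ip x y - g x) := by
  refine ⟨sqnorm y, ?_⟩
  rintro _ ⟨x, rfl⟩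
  have h : ip x y ≤ sqnorm x + sqnorm y := by
    unfold ip sqnorm
    rw [← Finset.sum_add_distrib]
    exact Finset.sum_le_sum fun i _ => by
      nlinarith [sq_nonneg (x i - y i), sq_nonneg (x i + y i)]
  have := hg x
  show ip x y - g x ≤ sqnorm y
  linarith

lemma sub_le_fconj {d : ℕ} {g : (Fin d → ℝ) → ℝ} (hg : ∀ v, sqnorm v ≤ g v)
    (x y : Fin d → ℝ) : ip x y - g x ≤ fconj g y :=
  le_ciSup (bddAbove_fconj hg y) x

lemma sub_le_fconj_fconj {d : ℕ} {g : (Fin d → ℝ) → ℝ} (hg : ∀ v, sqnorm v ≤ g v)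
    (x y : Fin d → ℝ) : ip y x - fconj g y ≤ fconj (fconj g) x := by
  refine le_ciSup (f := fun y => ip y x - fconj g y) ⟨g x, ?_⟩ y
  rintro _ ⟨z, rfl⟩
  have := sub_le_fconj hg x z
  have := ip_comm x z
  show ip z x - fconj g z ≤ g x
  linarith

lemma apply_abs_of_sign_invariant {d : ℕ} {f : (Fin d → ℝ) → ℝ}
    (hsign : ∀ (ε x : Fin d → ℝ), (∀ i, ε i = 1 ∨ ε i = -1) →
      f (fun i => ε i * x i) = f x) (x : Fin d → ℝ) : f (fun i => |x i|) = f x := by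
  rw [← hsign (fun i => sgnOne (x i)) x fun i => sgnOne_eq_or _]
  simp only [sgnOne_mul_self]

lemma apply_le_of_abs_le {d : ℕ} {f : (Fin d → ℝ) → ℝ}
    (hsign : ∀ (ε x : Fin d → ℝ), (∀ i, ε i = 1 ∨ ε i = -1) →
      f (fun i => ε i * x i) = f x)
    (hmono : ∀ x y : Fin d → ℝ, (∀ i, 0 ≤ x i) → (∀ i, 0 ≤ y i) → f x ≤ f (x + y))
    {x y : Fin d → ℝ} (h : ∀ i, |x i| ≤ |y i|) : f x ≤ f y := by
  rw [← apply_abs_of_sign_invariant hsign x, ← apply_abs_of_sign_invariant hsign y]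
  convert hmono (fun i => |x i|) (fun i => |y i| - |x i|) (fun i => abs_nonneg _)
    (fun i => sub_nonneg.mpr (h i)) using 2
  ext i
  simp

lemma sqnorm_le_of_abs_le {d : ℕ} {x y : Fin d → ℝ} (h : ∀ i, |x i| ≤ |y i|) :
    sqnorm x ≤ sqnorm y :=
  Finset.sum_le_sum fun i _ => sq_le_sq.mpr (h i)

section Conjugate

variable {d : ℕ} {g : (Fin d → ℝ) → ℝ} {lam : ℝ}

lemma fconj_add_l1_le (hg : ∀ v, sqnorm v ≤ g v)
    (hmono : ∀ x y : Fin d → ℝ, (∀ i, |x i| ≤ |y i|) → g x ≤ g y)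
    {y z : Fin d → ℝ} (hyz : ∀ i, |y i| ≤ |z i| + lam) :
    fconj (fun v => g v + lam * l1 v) y ≤ fconj g z := by
  refine ciSup_le fun x => ?_
  refine le_trans ?_ (sub_le_fconj hg (fun i => sgnOne (z i) * |x i|) z)
  have hgx : g (fun i => sgnOne (z i) * |x i|) ≤ g x :=
    hmono _ _ fun i => by simp [abs_mul, abs_sgnOne]
  have hip : ip x y ≤ ip (fun i => sgnOne (z i) * |x i|) z + lam * l1 x := by
    unfold ip l1
    rw [Finset.mul_sum, ← Finset.sum_add_distrib]
    refine Finset.sum_le_sum fun i _ => ?_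
    calc x i * y i ≤ |x i| * |y i| := (le_abs_self _).trans_eq (abs_mul _ _)
      _ ≤ |x i| * (|z i| + lam) := mul_le_mul_of_nonneg_left (hyz i) (abs_nonneg _)
      _ = sgnOne (z i) * |x i| * z i + lam * |x i| := by
        rw [← sgnOne_mul_self (z i)]
        ring
  linarith

lemma fconj_le_fconj_add_l1 (hlam : 0 ≤ lam) (hg : ∀ v, sqnorm v ≤ g v)
    (hmono : ∀ x y : Fin d → ℝ, (∀ i, |x i| ≤ |y i|) → g x ≤ g y)
    {y z : Fin d → ℝ} (hyz : ∀ i, |z i| ≤ max (|y i| - lam) 0) :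
    fconj g z ≤ fconj (fun v => g v + lam * l1 v) y := by
  refine ciSup_le fun x => ?_
  have hg' : ∀ v, sqnorm v ≤ g v + lam * l1 v := fun v =>
    (hg v).trans (le_add_of_nonneg_right (mul_nonneg hlam (l1_nonneg v)))
  set w : Fin d → ℝ := fun i => if lam ≤ |y i| then sgnOne (y i) * |x i| else 0 with hw
  refine le_trans ?_ (sub_le_fconj hg' w y)
  have hgw : g w ≤ g x := hmono _ _ fun i => by
    simp only [hw]
    split_ifs
    · simp [abs_mul, abs_sgnOne]
    · simp
  have hip : ip x z + lam * l1 w ≤ ip w y := by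
    unfold ip l1
    rw [Finset.mul_sum, ← Finset.sum_add_distrib]
    refine Finset.sum_le_sum fun i _ => ?_
    have hxz : x i * z i ≤ |x i| * max (|y i| - lam) 0 :=
      ((le_abs_self _).trans_eq (abs_mul _ _)).trans
        (mul_le_mul_of_nonneg_left (hyz i) (abs_nonneg _))
    simp only [hw]
    split_ifs with h
    · rw [max_eq_left (sub_nonneg.mpr h)] at hxz
      rw [abs_mul, abs_sgnOne, abs_abs, mul_right_comm, sgnOne_mul_self]
      linarith
    · rw [max_eq_right (by linarith)] at hxz
      simpa using hxz
  linarith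

/-- Adding `λ‖·‖₁` commutes with biconjugation for functions monotone in the absolute values of
the coordinates. -/
lemma fconj_fconj_add_l1 (hlam : 0 ≤ lam) (hg : ∀ v, sqnorm v ≤ g v)
    (hmono : ∀ x y : Fin d → ℝ, (∀ i, |x i| ≤ |y i|) → g x ≤ g y) (x : Fin d → ℝ) :
    fconj (fconj fun v => g v + lam * l1 v) x = fconj (fconj g) x + lam * l1 x := by
  have hg' : ∀ v, sqnorm v ≤ g v + lam * l1 v := fun v =>
    (hg v).trans (le_add_of_nonneg_right (mul_nonneg hlam (l1_nonneg v)))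
  apply le_antisymm
  · refine ciSup_le fun y => ?_
    set z : Fin d → ℝ := fun i => sgnOne (x i) * max (|y i| - lam) 0 with hz
    have hconj := fconj_le_fconj_add_l1 (y := y) (z := z) hlam hg hmono fun i => by
      rw [hz, abs_mul, abs_sgnOne, one_mul, abs_of_nonneg (le_max_right _ _)]
    have hip : ip y x ≤ ip z x + lam * l1 x := by
      unfold ip l1
      rw [Finset.mul_sum, ← Finset.sum_add_distrib]
      refine Finset.sum_le_sum fun i _ => ?_
      calc y i * x i ≤ |y i| * |x i| := (le_abs_self _).trans_eq (abs_mul _ _)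
        _ ≤ (max (|y i| - lam) 0 + lam) * |x i| :=
          mul_le_mul_of_nonneg_right (by linarith [le_max_left (|y i| - lam) 0]) (abs_nonneg _)
        _ = z i * x i + lam * |x i| := by
          rw [add_mul, ← sgnOne_mul_self (x i)]
          simp only [hz]
          ring
    have := sub_le_fconj_fconj hg x z
    linarith
  · rw [← le_sub_iff_add_le]
    refine ciSup_le fun z => ?_
    set y : Fin d → ℝ := fun i => sgnOne (x i) * (|z i| + lam) with hy
    have hconj := fconj_add_l1_le (y := y) (z := z) (lam := lam) hg hmono fun i => by
      rw [hy, abs_mul, abs_sgnOne, one_mul, abs_of_nonneg (by positivity)]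
    have hip : ip z x + lam * l1 x ≤ ip y x := by
      unfold ip l1
      rw [Finset.mul_sum, ← Finset.sum_add_distrib]
      refine Finset.sum_le_sum fun i _ => ?_
      calc z i * x i + lam * |x i| ≤ |z i| * |x i| + lam * |x i| :=
          add_le_add_left ((le_abs_self _).trans_eq (abs_mul _ _)) _
        _ = y i * x i := by
          rw [← sgnOne_mul_self (x i)]
          simp only [hy]
          ring
    have := sub_le_fconj_fconj hg' x y
    linarith

end Conjugate

/-- Theorem 1 of the paper: adding `λ‖·‖₁` before or after taking the quadratic
envelope makes no difference. -/
theorem stmt0 {d : ℕ} (f : (Fin d → ℝ) → ℝ) (lam : ℝ) (hlam : 0 ≤ lam)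
    (hlsc : LowerSemicontinuous f)
    (hsign : ∀ (ε x : Fin d → ℝ), (∀ i, ε i = 1 ∨ ε i = -1) →
      f (fun i => ε i * x i) = f x)
    (h0 : f 0 = 0)
    (hmono : ∀ x y : Fin d → ℝ, (∀ i, 0 ≤ x i) → (∀ i, 0 ≤ y i) → f x ≤ f (x + y))
    (x : Fin d → ℝ) :
    Q2 (fun v => f v + lam * l1 v) x = Q2 f x + lam * l1 x := by
  have hf := fun x y => apply_le_of_abs_le (x := x) (y := y) hsign hmono
  have hg : ∀ v, sqnorm v ≤ f v + sqnorm v := fun v => by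
    have := hf 0 v fun i => by simp
    linarith
  have key := fconj_fconj_add_l1 hlam hg
    (fun x y h => add_le_add (hf x y h) (sqnorm_le_of_abs_le h)) x
  unfold Q2
  simp only [add_right_comm _ (lam * l1 _), key]
  ring
end
end

section
/- Let μ > 0 and λ ≥ 0. Then for every x ∈ ℝ^d, Q_2(μ‖·‖₀ + λ‖·‖₁)(x) = Σᵢ (μ − max(√μ − |xᵢ|, 0)²) + λ‖x‖₁. -/
noncomputable section

open scoped BigOperators

/-- ℓ⁰ "norm": the number of nonzero entries of `x` -/
def l0 {d : ℕ} (x : Fin d → ℝ) : ℕ := (Finset.univ.filter fun i => x i ≠ 0).card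

/-- The Fenchel conjugate of a separable function whose coordinatewise suprema are attained. -/
lemma fconj_sum_eq_of_forall_isGreatest {d : ℕ} {g φ : ℝ → ℝ}
    (h : ∀ y, IsGreatest (Set.range fun t => t * y - g t) (φ y)) (y : Fin d → ℝ) :
    fconj (fun v => ∑ i, g (v i)) y = ∑ i, φ (y i) := by
  choose t ht using fun y => (h y).1
  have key : IsGreatest (Set.range fun v : Fin d → ℝ => ip v y - ∑ i, g (v i))
      (∑ i, φ (y i)) := by
    simp only [ip, ← Finset.sum_sub_distrib]
    refine ⟨⟨fun i => t (y i), Finset.sum_congr rfl fun i _ => ht (y i)⟩, ?_⟩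
    rintro _ ⟨v, rfl⟩
    exact Finset.sum_le_sum fun i _ => (h (y i)).2 ⟨v i, rfl⟩
  exact key.csSup_eq

lemma exists_abs_eq_and_mul_eq (y : ℝ) {r : ℝ} (hr : 0 ≤ r) :
    ∃ t : ℝ, |t| = r ∧ t * y = r * |y| := by
  rcases abs_cases y with ⟨h, -⟩ | ⟨h, -⟩
  · exact ⟨r, abs_of_nonneg hr, by rw [h]⟩
  · exact ⟨-r, by rw [abs_neg, abs_of_nonneg hr], by rw [h]; ring⟩

lemma isGreatest_conj_card_add_abs_add_sq {s lam : ℝ} (hs : 0 < s) (y : ℝ) :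
    IsGreatest
      (Set.range fun t : ℝ => t * y - ((if t ≠ 0 then s ^ 2 else 0) + lam * |t| + t ^ 2))
      (max ((max ((|y| - lam) / 2) 0) ^ 2 - s ^ 2) 0) := by
  constructor
  · rcases le_or_gt ((|y| - lam) / 2) s with h | h
    · have hm : max ((|y| - lam) / 2) 0 ^ 2 ≤ s ^ 2 :=
        pow_le_pow_left₀ (le_max_right _ _) (max_le h hs.le) 2
      exact ⟨0, by rw [max_eq_right (sub_nonpos.2 hm)]; simp⟩
    · obtain ⟨t, ht, hty⟩ := exists_abs_eq_and_mul_eq y (hs.trans h).le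
      have ht0 : t ≠ 0 := by
        rw [← abs_pos, ht]
        exact hs.trans h
      refine ⟨t, ?_⟩
      simp only [if_pos ht0]
      rw [max_eq_left (hs.trans h).le, max_eq_left (by nlinarith), hty, ← sq_abs t, ht]
      ring
  · rintro _ ⟨t, rfl⟩
    by_cases ht : t = 0
    · simp [ht]
    · refine le_max_of_le_left ?_
      have h1 : t * y ≤ |t| * |y| := (le_abs_self _).trans (abs_mul t y).le
      simp only [if_pos ht]
      rw [← sq_abs t]
      have h2 := le_max_left ((|y| - lam) / 2) 0
      nlinarith [sq_nonneg (max ((|y| - lam) / 2) 0 - |t|),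
        mul_le_mul_of_nonneg_left h2 (abs_nonneg t)]

lemma isGreatest_biconj_card_add_abs_add_sq {s lam : ℝ} (hs : 0 < s) (hlam : 0 ≤ lam) (x : ℝ) :
    IsGreatest
      (Set.range fun y : ℝ => y * x - max ((max ((|y| - lam) / 2) 0) ^ 2 - s ^ 2) 0)
      (s ^ 2 - max (s - |x|) 0 ^ 2 + lam * |x| + x ^ 2) := by
  have hx := abs_nonneg x
  rw [← sq_abs x]
  constructor
  · have hm : 0 ≤ max s |x| := le_max_of_le_right hx
    obtain ⟨y, hy, hyx⟩ := exists_abs_eq_and_mul_eq x (r := lam + 2 * max s |x|) (by positivity)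
    refine ⟨y, ?_⟩
    have hc : (|y| - lam) / 2 = max s |x| := by rw [hy]; ring
    simp only [hc, hyx, max_eq_left hm]
    rcases le_total s |x| with h | h
    · rw [max_eq_right h, max_eq_left (by nlinarith), max_eq_right (by linarith)]
      ring
    · rw [max_eq_left h, sub_self, max_self, max_eq_left (sub_nonneg.2 h)]
      ring
  · rintro _ ⟨y, rfl⟩
    have h1 : y * x ≤ |y| * |x| := (le_abs_self _).trans (abs_mul y x).le
    have h2 := le_max_left ((|y| - lam) / 2) 0
    have h3 := mul_le_mul_of_nonneg_left h2 hx
    have h4 := le_max_left (max ((|y| - lam) / 2) 0 ^ 2 - s ^ 2) 0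
    have h5 := le_max_right (max ((|y| - lam) / 2) 0 ^ 2 - s ^ 2) 0
    dsimp only
    generalize max ((|y| - lam) / 2) 0 = c at *
    generalize max (c ^ 2 - s ^ 2) 0 = p at *
    rcases le_total s |x| with h | h
    · rw [max_eq_right (by linarith)]
      nlinarith [sq_nonneg (c - |x|)]
    · rw [max_eq_left (by linarith)]
      rcases le_total c s with h6 | h6
      · nlinarith [mul_nonneg hx (sub_nonneg.2 h6)]
      · nlinarith [mul_nonneg (sub_nonneg.2 h6) (sub_nonneg.2 h)]

/-- `Q₂(μ‖·‖₀ + λ‖·‖₁)(x) = Σᵢ (μ − max(√μ − |xᵢ|, 0)²) + λ‖x‖₁`. -/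
theorem stmt1 {d : ℕ} (μ lam : ℝ) (hμ : 0 < μ) (hlam : 0 ≤ lam) (x : Fin d → ℝ) :
    Q2 (fun v => μ * (l0 v : ℝ) + lam * l1 v) x =
      (∑ i, (μ - max (Real.sqrt μ - |x i|) 0 ^ 2)) + lam * l1 x := by
  have hs : 0 < Real.sqrt μ := Real.sqrt_pos.2 hμ
  have hμs : Real.sqrt μ ^ 2 = μ := Real.sq_sqrt hμ.le
  have hsep : (fun v : Fin d → ℝ => μ * (l0 v : ℝ) + lam * l1 v + sqnorm v) = fun v =>
      ∑ i, ((if v i ≠ 0 then Real.sqrt μ ^ 2 else 0) + lam * |v i| + v i ^ 2) := by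
    funext v
    simp only [l0, l1, sqnorm, hμs, Finset.sum_add_distrib, Finset.mul_sum, Finset.card_filter,
      Nat.cast_sum, Nat.cast_ite, Nat.cast_one, Nat.cast_zero, mul_ite, mul_one, mul_zero]
  unfold Q2
  rw [hsep, funext (fconj_sum_eq_of_forall_isGreatest
      (isGreatest_conj_card_add_abs_add_sq hs)),
    fconj_sum_eq_of_forall_isGreatest (isGreatest_biconj_card_add_abs_add_sq hs hlam)]
  simp only [hμs, Finset.sum_add_distrib, l1, sqnorm, Finset.mul_sum]
  ring
end
end

section
/- Let μ > 0, λ ≥ 0, and z ∈ ℝ. The set of minimizers over x ∈ ℝ of the function x ↦ μ − max(√μ − |x|, 0)² + λ|x| + (x − z)² equals: {z − sign(z)·λ/2} if |z| > √μ + λ/2; {sign(z)·t : t ∈ [0, √μ]} if |z| = √μ + λ/2; and {0} if |z| < √μ + λ/2. -/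
noncomputable section

/-- the one-dimensional objective `μ − max(√μ − |x|, 0)² + λ|x| + (x − z)²` -/
def obj (μ lam z x : ℝ) : ℝ :=
  μ - max (Real.sqrt μ - |x|) 0 ^ 2 + lam * |x| + (x - z) ^ 2

theorem obj_of_abs_le {μ x : ℝ} (hμ : 0 ≤ μ) (lam z : ℝ) (h : |x| ≤ Real.sqrt μ) :
    obj μ lam z x = z ^ 2 + 2 * (Real.sqrt μ + lam / 2) * |x| - 2 * (x * z) := by
  rw [obj, max_eq_left (sub_nonneg.2 h)]
  linear_combination -Real.sq_sqrt hμ - sq_abs x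

theorem obj_of_le_abs {μ x : ℝ} (lam z : ℝ) (h : Real.sqrt μ ≤ |x|) :
    obj μ lam z x = z ^ 2 + μ + |x| ^ 2 + lam * |x| - 2 * (x * z) := by
  rw [obj, max_eq_right (sub_nonpos.2 h)]
  linear_combination -sq_abs x

theorem mul_le_abs_mul_abs (x z : ℝ) : x * z ≤ |x| * |z| :=
  abs_mul x z ▸ le_abs_self (x * z)

theorem sign_mul_abs_eq_of_abs_mul_abs_le {x z : ℝ} (hz : z ≠ 0) (h : |x| * |z| ≤ x * z) :
    x = Real.sign z * |x| := by
  rw [← abs_mul] at h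
  have hxz : 0 ≤ x * z := (abs_nonneg _).trans h
  rcases lt_or_gt_of_ne hz with hz | hz
  · rw [Real.sign_of_neg hz, abs_of_nonpos (nonpos_of_mul_nonneg_left hxz hz)]
    ring
  · rw [Real.sign_of_pos hz, abs_of_nonneg (nonneg_of_mul_nonneg_left hxz hz)]
    ring

theorem real_sign_mul_abs_self (z : ℝ) : Real.sign z * |z| = z := by
  rcases lt_trichotomy z 0 with hz | rfl | hz
  · rw [Real.sign_of_neg hz, abs_of_neg hz]
    ring
  · simp
  · rw [Real.sign_of_pos hz, abs_of_pos hz]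
    ring

theorem real_sign_mul_self (z : ℝ) : Real.sign z * z = |z| := by
  rcases lt_trichotomy z 0 with hz | rfl | hz
  · rw [Real.sign_of_neg hz, abs_of_neg hz]
    ring
  · simp
  · rw [Real.sign_of_pos hz, abs_of_pos hz]
    ring

theorem abs_sign_mul {z t : ℝ} (hz : z ≠ 0) (ht : 0 ≤ t) : |Real.sign z * t| = t := by
  rcases lt_or_gt_of_ne hz with hz | hz
  · simp [Real.sign_of_neg hz, abs_of_nonneg ht]
  · simp [Real.sign_of_pos hz, abs_of_nonneg ht]

theorem setOf_forall_le_eq {f : ℝ → ℝ} {S : Set ℝ} (m : ℝ) (hS : S.Nonempty)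
    (hle : ∀ w, m ≤ f w) (hmem : ∀ x, x ∈ S → f x = m) (heq : ∀ x, f x ≤ m → x ∈ S) :
    {x | ∀ w, f x ≤ f w} = S := by
  ext x
  refine ⟨fun hx => ?_, fun hx w => (hmem x hx).trans_le (hle w)⟩
  obtain ⟨y, hy⟩ := hS
  exact heq x ((hx y).trans (hmem y hy).le)

/-- Characterization of the minimizers of
`x ↦ μ − max(√μ − |x|, 0)² + λ|x| + (x − z)²`. -/
theorem stmt3 (μ lam z : ℝ) (hμ : 0 < μ) (hlam : 0 ≤ lam) :
    (|z| > Real.sqrt μ + lam / 2 →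
      {x : ℝ | ∀ w : ℝ, obj μ lam z x ≤ obj μ lam z w}
        = {z - Real.sign z * (lam / 2)}) ∧
    (|z| = Real.sqrt μ + lam / 2 →
      {x : ℝ | ∀ w : ℝ, obj μ lam z x ≤ obj μ lam z w}
        = (fun t => Real.sign z * t) '' Set.Icc 0 (Real.sqrt μ)) ∧
    (|z| < Real.sqrt μ + lam / 2 →
      {x : ℝ | ∀ w : ℝ, obj μ lam z x ≤ obj μ lam z w} = {0}) := by
  have hs : 0 < Real.sqrt μ := Real.sqrt_pos.2 hμ
  have hsq := Real.sq_sqrt hμ.le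
  refine ⟨fun h => ?_, fun h => ?_, fun h => ?_⟩
  · have hz : z ≠ 0 := abs_pos.1 (by linarith)
    have hx₀ : z - Real.sign z * (lam / 2) = Real.sign z * (|z| - lam / 2) := by
      rw [mul_sub, real_sign_mul_abs_self]
    have hc : 0 ≤ |z| - lam / 2 := by linarith
    rw [hx₀]
    refine setOf_forall_le_eq (z ^ 2 + μ - (|z| - lam / 2) ^ 2) (Set.singleton_nonempty _)
      (fun x => ?_) (fun x hx => ?_) (fun x hx => ?_)
    · have hm := mul_le_abs_mul_abs x z
      rcases le_total |x| (Real.sqrt μ) with hx | hx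
      · rw [obj_of_abs_le hμ.le _ _ hx]
        nlinarith [mul_nonneg (sub_nonneg.2 hx) (sub_nonneg.2 h.le),
          sq_nonneg (|z| - lam / 2 - Real.sqrt μ)]
      · rw [obj_of_le_abs _ _ hx]
        nlinarith [sq_nonneg (|x| - (|z| - lam / 2))]
    · rw [Set.mem_singleton_iff] at hx
      have habs := abs_sign_mul hz hc
      rw [← hx] at habs
      rw [obj_of_le_abs _ _ (by linarith), habs, hx]
      linear_combination -2 * (|z| - lam / 2) * real_sign_mul_self z
    · have hm := mul_le_abs_mul_abs x z
      rcases le_total |x| (Real.sqrt μ) with hx' | hx'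
      · rw [obj_of_abs_le hμ.le _ _ hx'] at hx
        have hpos : 0 < |z| - lam / 2 - Real.sqrt μ := by linarith
        nlinarith [mul_nonneg (sub_nonneg.2 hx') hpos.le, pow_pos hpos 2]
      · rw [obj_of_le_abs _ _ hx'] at hx
        have habs : |x| - (|z| - lam / 2) = 0 := by
          refine pow_eq_zero_iff two_ne_zero |>.1 (le_antisymm ?_ (sq_nonneg _))
          nlinarith
        have hsign := sign_mul_abs_eq_of_abs_mul_abs_le (x := x) hz
          (by nlinarith [sq_nonneg (|x| - (|z| - lam / 2))])
        rwa [sub_eq_zero.1 habs] at hsign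
  · have hz : z ≠ 0 := abs_pos.1 (by linarith)
    refine setOf_forall_le_eq (z ^ 2) ((Set.nonempty_Icc.2 hs.le).image _)
      (fun x => ?_) (fun x hx => ?_) (fun x hx => ?_)
    · have hm := mul_le_abs_mul_abs x z
      rcases le_total |x| (Real.sqrt μ) with hx | hx
      · rw [obj_of_abs_le hμ.le _ _ hx, ← h]
        linarith
      · rw [obj_of_le_abs _ _ hx]
        rw [h] at hm
        nlinarith [sq_nonneg (|x| - Real.sqrt μ)]
    · obtain ⟨t, ht, rfl⟩ := hx
      have habs := abs_sign_mul hz ht.1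
      simp only
      rw [obj_of_abs_le hμ.le _ _ (habs.trans_le ht.2), habs, ← h]
      linear_combination -2 * t * real_sign_mul_self z
    · have hm := mul_le_abs_mul_abs x z
      rcases le_total |x| (Real.sqrt μ) with hx' | hx'
      · rw [obj_of_abs_le hμ.le _ _ hx', ← h] at hx
        exact ⟨|x|, ⟨abs_nonneg x, hx'⟩,
          (sign_mul_abs_eq_of_abs_mul_abs_le hz (by linarith)).symm⟩
      · rw [obj_of_le_abs _ _ hx'] at hx
        have hlow : |x| * |z| = |x| * (Real.sqrt μ + lam / 2) := by rw [h]
        have habs : |x| - Real.sqrt μ = 0 := by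
          refine pow_eq_zero_iff two_ne_zero |>.1 (le_antisymm ?_ (sq_nonneg _))
          nlinarith
        exact ⟨|x|, ⟨abs_nonneg x, (sub_eq_zero.1 habs).le⟩,
          (sign_mul_abs_eq_of_abs_mul_abs_le hz
            (by nlinarith [sq_nonneg (|x| - Real.sqrt μ)])).symm⟩
  · have hlow (x : ℝ) :
        z ^ 2 + 2 * (Real.sqrt μ + lam / 2 - |z|) * |x| ≤ obj μ lam z x := by
      have hm := mul_le_abs_mul_abs x z
      rcases le_total |x| (Real.sqrt μ) with hx | hx
      · rw [obj_of_abs_le hμ.le _ _ hx]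
        linarith
      · rw [obj_of_le_abs _ _ hx]
        nlinarith [sq_nonneg (|x| - Real.sqrt μ)]
    have hpos : 0 < Real.sqrt μ + lam / 2 - |z| := sub_pos.2 h
    refine setOf_forall_le_eq (z ^ 2) (Set.singleton_nonempty _)
      (fun x => ?_) (fun x hx => ?_) (fun x hx => ?_)
    · exact (le_add_of_nonneg_right (by positivity)).trans (hlow x)
    · rw [Set.mem_singleton_iff.1 hx, obj_of_abs_le hμ.le _ _ (by simp)]
      simp
    · by_contra hne
      have : 0 < (Real.sqrt μ + lam / 2 - |z|) * |x| := mul_pos hpos (abs_pos.2 hne)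
      linarith [hlow x]
end
end

section
/- Let μ > 0 and λ ≥ 0. The function g_λ : ℝ^d → ℝ defined by g_λ(x) = Σᵢ (μ − max(√μ − |xᵢ|, 0)²) + λ‖x‖₁ + ‖x‖² is convex. -/
noncomputable section

open scoped BigOperators

/-- Writing `s² - max (s - |t|) 0 ^ 2 + t²` as `2 s |t| + max (|t| - s) 0 ^ 2` exhibits its
convexity. -/
theorem sq_sub_max_sq_add_sq (s t : ℝ) :
    s ^ 2 - max (s - |t|) 0 ^ 2 + t ^ 2 = 2 * s * |t| + max (|t| - s) 0 ^ 2 := by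
  rw [← sq_abs t]
  rcases le_total s |t| with h | h
  · rw [max_eq_right (sub_nonpos.2 h), max_eq_left (sub_nonneg.2 h)]; ring
  · rw [max_eq_left (sub_nonneg.2 h), max_eq_right (sub_nonpos.2 h)]; ring

theorem convexOn_mul_abs_add_max_sq {c : ℝ} (hc : 0 ≤ c) (s : ℝ) :
    ConvexOn ℝ Set.univ (fun t : ℝ => c * |t| + max (|t| - s) 0 ^ 2) := by
  have habs : ConvexOn ℝ Set.univ (fun t : ℝ => |t|) := convexOn_univ_norm
  have hmax : ConvexOn ℝ Set.univ (fun t : ℝ => max (|t| - s) 0) :=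
    (habs.sub (concaveOn_const s convex_univ)).sup (convexOn_const 0 convex_univ)
  exact (habs.smul hc).add (hmax.pow (fun _ _ => le_max_right _ _) 2)

/-- `g_λ(x) = Σᵢ (μ − max(√μ − |xᵢ|, 0)²) + λ‖x‖₁ + ‖x‖²` is convex. -/
theorem stmt4 {d : ℕ} (μ lam : ℝ) (hμ : 0 < μ) (hlam : 0 ≤ lam) :
    ConvexOn ℝ Set.univ
      (fun x : Fin d → ℝ =>
        (∑ i, (μ - max (Real.sqrt μ - |x i|) 0 ^ 2)) + lam * l1 x + sqnorm x) := by
  have hc : 0 ≤ 2 * Real.sqrt μ + lam := by positivity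
  have hsum : ConvexOn ℝ Set.univ (fun x : Fin d → ℝ =>
      ∑ i, ((2 * Real.sqrt μ + lam) * |x i| + max (|x i| - Real.sqrt μ) 0 ^ 2)) := by
    refine ⟨convex_univ, fun x _ y _ a b ha hb hab => ?_⟩
    simp only [Finset.smul_sum, ← Finset.sum_add_distrib]
    exact Finset.sum_le_sum fun i _ =>
      (convexOn_mul_abs_add_max_sq hc (Real.sqrt μ)).2 trivial trivial ha hb hab
  convert hsum using 2 with x
  simp only [l1, sqnorm, Finset.mul_sum, ← Finset.sum_add_distrib]
  refine Finset.sum_congr rfl fun i _ => ?_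
  have h := sq_sub_max_sq_add_sq (Real.sqrt μ) (x i)
  rw [Real.sq_sqrt hμ.le] at h
  linarith
end
end

section
/- Let μ > 0 and λ ≥ 0, and define the convex function g_λ : ℝ → ℝ by g_λ(x) = μ − max(√μ − |x|, 0)² + λ|x| + x². Its convex subdifferential is: ∂g_λ(x) = {2x + λ·sign(x)} if |x| ≥ √μ; ∂g_λ(x) = {(2√μ + λ)·sign(x)} if 0 < |x| ≤ √μ; and ∂g_λ(0) = [−2√μ − λ, 2√μ + λ]. -/
noncomputable section

/-- subdifferential of a function `g : ℝ → ℝ` at `x` -/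
def subdiff (g : ℝ → ℝ) (x : ℝ) : Set ℝ :=
  {s : ℝ | ∀ y : ℝ, g x + s * (y - x) ≤ g y}

/-- `g_λ(x) = μ − max(√μ − |x|, 0)² + λ|x| + x²` -/
def gfun (μ lam x : ℝ) : ℝ :=
  μ - max (Real.sqrt μ - |x|) 0 ^ 2 + lam * |x| + x ^ 2

/-- The positive part in `gfun` expressed through `max (√μ) |x|`. -/
theorem gfun_eq_max (μ lam x : ℝ) :
    gfun μ lam x = μ + (lam + 2 * max (Real.sqrt μ) |x|) * |x| - max (Real.sqrt μ) |x| ^ 2 := by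
  have h : max (Real.sqrt μ - |x|) 0 = max (Real.sqrt μ) |x| - |x| := by
    rw [← max_sub_sub_right, sub_self]
  rw [gfun, h, ← sq_abs x]
  ring

/-- `gfun` is the supremum over `m ≥ √μ` of the functions on the left. -/
theorem le_gfun (μ lam : ℝ) {m : ℝ} (hm : Real.sqrt μ ≤ m) (y : ℝ) :
    μ + (lam + 2 * m) * |y| - m ^ 2 ≤ gfun μ lam y := by
  rw [gfun_eq_max μ]
  rcases max_cases (Real.sqrt μ) |y| with ⟨h, h'⟩ | ⟨h, h'⟩ <;> rw [h]
  · nlinarith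
  · nlinarith [sq_nonneg (m - |y|)]

theorem gfun_le_quadratic (μ lam : ℝ) {x y : ℝ} (hx : 0 < x) (hy : 0 ≤ y) :
    gfun μ lam y ≤
      gfun μ lam x + (lam + 2 * max (Real.sqrt μ) x) * (y - x) + (y - x) ^ 2 := by
  rw [gfun_eq_max μ, gfun_eq_max μ, abs_of_pos hx, abs_of_nonneg hy]
  rcases max_cases (Real.sqrt μ) x with ⟨h, h'⟩ | ⟨h, h'⟩ <;>
  rcases max_cases (Real.sqrt μ) y with ⟨k, k'⟩ | ⟨k, k'⟩ <;> rw [h, k] <;> nlinarith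

theorem gfun_neg (μ lam x : ℝ) : gfun μ lam (-x) = gfun μ lam x := by
  simp [gfun]

theorem neg_mem_subdiff_gfun {μ lam x s : ℝ} (h : s ∈ subdiff (gfun μ lam) x) :
    -s ∈ subdiff (gfun μ lam) (-x) := by
  intro y
  have := h (-y)
  rw [gfun_neg] at this ⊢
  linarith

theorem subdiff_gfun_of_pos {μ lam x : ℝ} (hlam : 0 ≤ lam) (hx : 0 < x) :
    subdiff (gfun μ lam) x = {lam + 2 * max (Real.sqrt μ) x} := by
  ext s
  rw [Set.mem_singleton_iff]
  constructor
  · intro hs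
    have key : ∀ d, -x ≤ d → (s - (lam + 2 * max (Real.sqrt μ) x)) * d ≤ d ^ 2 := by
      intro d hd
      have h₁ := hs (x + d)
      have h₂ := gfun_le_quadratic μ lam hx (show 0 ≤ x + d by linarith)
      rw [add_sub_cancel_left] at h₁ h₂
      linarith
    generalize lam + 2 * max (Real.sqrt μ) x = c at key
    rcases lt_trichotomy s c with h | h | h
    · have hd : 0 < min x ((c - s) / 2) := lt_min hx (by linarith)
      have h₁ := key (-min x ((c - s) / 2)) (neg_le_neg (min_le_left _ _))
      nlinarith [min_le_right x ((c - s) / 2)]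
    · exact h
    · nlinarith [key ((s - c) / 2) (by linarith)]
  · rintro rfl y
    have h₁ := le_gfun μ lam (le_max_left (Real.sqrt μ) x) y
    have hm : 0 ≤ max (Real.sqrt μ) x := hx.le.trans (le_max_right _ _)
    rw [gfun_eq_max μ lam x, abs_of_pos hx]
    nlinarith [le_abs_self y]

theorem subdiff_gfun_of_ne_zero {μ lam x : ℝ} (hlam : 0 ≤ lam) (hx : x ≠ 0) :
    subdiff (gfun μ lam) x = {(lam + 2 * max (Real.sqrt μ) |x|) * Real.sign x} := by
  rcases hx.lt_or_gt with h | h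
  · rw [Real.sign_of_neg h, abs_of_neg h]
    have hpos := subdiff_gfun_of_pos (μ := μ) hlam (neg_pos.2 h)
    ext s
    have hs : s ∈ subdiff (gfun μ lam) x ↔ -s ∈ subdiff (gfun μ lam) (-x) :=
      ⟨neg_mem_subdiff_gfun, fun h => by simpa using neg_mem_subdiff_gfun h⟩
    rw [hs, hpos, Set.mem_singleton_iff, Set.mem_singleton_iff, mul_neg_one, neg_eq_iff_eq_neg]
  · rw [Real.sign_of_pos h, abs_of_pos h, mul_one, subdiff_gfun_of_pos hlam h]

theorem subdiff_gfun_zero {μ : ℝ} (hμ : 0 < μ) (lam : ℝ) :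
    subdiff (gfun μ lam) 0 =
      Set.Icc (-(2 * Real.sqrt μ) - lam) (2 * Real.sqrt μ + lam) := by
  have ha := Real.sqrt_pos.2 hμ
  have hsq := Real.sq_sqrt hμ.le
  have h₀ : gfun μ lam 0 = 0 := by simp [gfun, ha.le, hsq]
  have h₁ : gfun μ lam (Real.sqrt μ) = (2 * Real.sqrt μ + lam) * Real.sqrt μ := by
    rw [gfun_eq_max μ, abs_of_pos ha, max_self]
    linarith
  ext s
  rw [Set.mem_Icc]
  constructor
  · intro hs
    have h₂ := hs (Real.sqrt μ)
    have h₃ := hs (-Real.sqrt μ)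
    rw [gfun_neg] at h₃
    rw [h₀, h₁] at h₂ h₃
    constructor <;> nlinarith
  · rintro ⟨hl, hu⟩ y
    have h₂ := le_gfun μ lam le_rfl y
    rw [hsq] at h₂
    have h₃ : s * y ≤ (2 * Real.sqrt μ + lam) * |y| :=
      (le_abs_self _).trans <| by
        rw [abs_mul]
        exact mul_le_mul_of_nonneg_right (abs_le.2 ⟨by linarith, hu⟩) (abs_nonneg y)
    rw [h₀]
    linarith

/-- Characterization of the subdifferential of `g_λ`. -/
theorem stmt5 (μ lam : ℝ) (hμ : 0 < μ) (hlam : 0 ≤ lam) :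
    (∀ x : ℝ, Real.sqrt μ ≤ |x| →
      subdiff (gfun μ lam) x = {2 * x + lam * Real.sign x}) ∧
    (∀ x : ℝ, 0 < |x| → |x| ≤ Real.sqrt μ →
      subdiff (gfun μ lam) x = {(2 * Real.sqrt μ + lam) * Real.sign x}) ∧
    subdiff (gfun μ lam) 0 =
      Set.Icc (-(2 * Real.sqrt μ) - lam) (2 * Real.sqrt μ + lam) := by
  refine ⟨fun x hx => ?_, fun x hx hxμ => ?_, subdiff_gfun_zero hμ lam⟩
  · have hx₀ : x ≠ 0 := abs_pos.1 ((Real.sqrt_pos.2 hμ).trans_le hx)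
    rw [subdiff_gfun_of_ne_zero hlam hx₀, max_eq_right hx]
    rcases hx₀.lt_or_gt with h | h
    · rw [Real.sign_of_neg h, abs_of_neg h]
      ring_nf
    · rw [Real.sign_of_pos h, abs_of_pos h]
      ring_nf
  · rw [subdiff_gfun_of_ne_zero hlam (abs_pos.1 hx), max_eq_left hxμ, add_comm lam]
end
end
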